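/- Assume Condition 1, and assume that the limit distribution p is not concentrated at 0 or at 1, i.e., p_0 < 1 and p_1 < 1. For κ ≥ 1, let T_κ be a plane rooted tree with m_κ := |T_κ| → ∞ as κ → ∞. If |n_κ| · π_{p(n_κ)}(T_κ) → λ as κ → ∞ for some λ ∈ [0,∞), then N_{T_κ}(𝒯_{n_κ}) converges in distribution to the Poisson distribution Po(λ), with convergence of all moments. -/

import Mathlib

/-!
Common definitions: plane rooted trees, fringe subtree counts, random trees with
a given degree statistic, Poisson/normal limit notions, conditioned Galton–Watson
trees, and sampling without replacement.
-/

open Filter MeasureTheory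
open scoped Topology Classical

/-- A plane rooted tree: a root together with a linearly ordered (possibly empty)
list of subtrees. Structural equality coincides with isomorphism of plane rooted trees. -/
inductive PlaneTree : Type
  | node : List PlaneTree → PlaneTree

namespace PlaneTree

/-- The (out)degree of the root: its number of children. -/
def degree : PlaneTree → ℕ
  | node ts => ts.length

mutual
  /-- The list of all fringe subtrees of a tree (one for each vertex). -/
  def fringe : PlaneTree → List PlaneTree
    | node ts => node ts :: fringeList ts
  def fringeList : List PlaneTree → List PlaneTree
    | [] => []
    | t :: ts => fringe t ++ fringeList ts
end

/-- The number of vertices `|T|` of a plane tree. -/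
def size (T : PlaneTree) : ℕ := T.fringe.length

/-- The degree statistic `n_T` of a tree: `n_T(i)` is the number of vertices with `i` children. -/
noncomputable def degStat (T : PlaneTree) : ℕ →₀ ℕ :=
  Multiset.toFinsupp ((T.fringe.map degree : List ℕ) : Multiset ℕ)

/-- `N_{T'}(T)`: the number of fringe subtrees of `T` equal to `T'`. -/
noncomputable def countTree (T' T : PlaneTree) : ℕ :=
  (T.fringe.filter fun t => decide (t = T')).length

/-- `N_m(T)` for a degree statistic `m`: the number of fringe subtrees of `T`
with degree statistic `m`. -/
noncomputable def countStat (m : ℕ →₀ ℕ) (T : PlaneTree) : ℕ :=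
  (T.fringe.filter fun t => decide (degStat t = m)).length

/-- `N_m(T)` for an integer `m`: the number of fringe subtrees of `T` of size `m`. -/
noncomputable def countSize (m : ℕ) (T : PlaneTree) : ℕ :=
  (T.fringe.filter fun t => decide (size t = m)).length

end PlaneTree

/-- `n : ℕ →₀ ℕ` is a degree statistic: `∑ n(i) = 1 + ∑ i·n(i)`. -/
def IsDegStat (n : ℕ →₀ ℕ) : Prop :=
  (n.sum fun _ c => c) = 1 + n.sum fun i c => i * c

/-- `|n| = ∑_i n(i)`, the size of a degree statistic. -/
def nsize (n : ℕ →₀ ℕ) : ℕ := n.sum fun _ c => c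

/-- The set `𝕋_n` of plane trees with degree statistic `n`. -/
def treesWith (n : ℕ →₀ ℕ) : Set PlaneTree := {T | PlaneTree.degStat T = n}

/-- `|𝕋_n|`, the number of plane trees with degree statistic `n`. -/
noncomputable def numTrees (n : ℕ →₀ ℕ) : ℕ := (treesWith n).ncard

/-- The probability that a uniformly random tree `𝒯_n ∈ 𝕋_n` satisfies `P`. -/
noncomputable def prob (n : ℕ →₀ ℕ) (P : PlaneTree → Prop) : ℝ :=
  (({T ∈ treesWith n | P T}).ncard : ℝ) / (numTrees n : ℝ)

/-- The expectation `E[f(𝒯_n)]` of an `ℕ`-valued functional of the uniformly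
random tree `𝒯_n ∈ 𝕋_n`. -/
noncomputable def expect (n : ℕ →₀ ℕ) (f : PlaneTree → ℕ) : ℝ :=
  ∑' k : ℕ, (k : ℝ) * prob n (fun T => f T = k)

/-- The variance `Var[f(𝒯_n)]`. -/
noncomputable def variance (n : ℕ →₀ ℕ) (f : PlaneTree → ℕ) : ℝ :=
  expect n (fun T => (f T) ^ 2) - (expect n f) ^ 2

/-- The empirical degree distribution `p_i(n) = n(i)/|n|`. -/
noncomputable def empDist (n : ℕ →₀ ℕ) (i : ℕ) : ℝ := (n i : ℝ) / (nsize n : ℝ)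

/-- `π_p(T) = ∏_{i ≥ 0} p_i^{n_T(i)}`. -/
noncomputable def piDist (p : ℕ → ℝ) (T : PlaneTree) : ℝ :=
  (PlaneTree.degStat T).prod fun i c => p i ^ c

/-- `π_p(𝕋_m) = |𝕋_m| · ∏_{i ≥ 0} p_i^{m(i)}`. -/
noncomputable def piSet (p : ℕ → ℝ) (m : ℕ →₀ ℕ) : ℝ :=
  (numTrees m : ℝ) * m.prod fun i c => p i ^ c

/-- Condition 1: the `nseq κ` are degree statistics with `|n_κ| → ∞` and
`p_i(n_κ) → p_i` for every `i`, where `p` is a probability distribution on `ℕ`. -/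
def Condition1 (nseq : ℕ → (ℕ →₀ ℕ)) (p : ℕ → ℝ) : Prop :=
  (∀ κ, IsDegStat (nseq κ)) ∧
  Tendsto (fun κ => nsize (nseq κ)) atTop atTop ∧
  (∀ i, 0 ≤ p i) ∧ HasSum p 1 ∧
  (∀ i, Tendsto (fun κ => empDist (nseq κ) i) atTop (𝓝 (p i)))

/-- Condition 2: in addition, `∑ i² p_i(n_κ) → ∑ i² p_i < ∞`. -/
def Condition2 (nseq : ℕ → (ℕ →₀ ℕ)) (p : ℕ → ℝ) : Prop :=
  Summable (fun i : ℕ => (i : ℝ) ^ 2 * p i) ∧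
  Tendsto (fun κ => ∑' i : ℕ, (i : ℝ) ^ 2 * empDist (nseq κ) i) atTop
    (𝓝 (∑' i : ℕ, (i : ℝ) ^ 2 * p i))

/-- `σ_p² = ∑_{i ≥ 0} (i-1)² p_i`. -/
noncomputable def sigmaSq (p : ℕ → ℝ) : ℝ := ∑' i : ℕ, ((i : ℝ) - 1) ^ 2 * p i

/-- The point probabilities of the Poisson distribution `Po(lam)`. -/
noncomputable def poissonPMF (lam : ℝ) (k : ℕ) : ℝ :=
  Real.exp (-lam) * lam ^ k / (Nat.factorial k : ℝ)

/-- The `q`-th moment of the Poisson distribution `Po(lam)`. -/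
noncomputable def poissonMoment (lam : ℝ) (q : ℕ) : ℝ :=
  ∑' k : ℕ, (k : ℝ) ^ q * poissonPMF lam k

/-- The standard normal cumulative distribution function. -/
noncomputable def stdNormalCDF (x : ℝ) : ℝ :=
  ∫ t in Set.Iic x, Real.exp (-t ^ 2 / 2) / Real.sqrt (2 * Real.pi)

/-- The total variation distance between the law of `f(𝒯_n)` and `Po(lam)`:
`sup_A |P(f(𝒯_n) ∈ A) − Po(lam)(A)|`. -/
noncomputable def dTVPoisson (n : ℕ →₀ ℕ) (f : PlaneTree → ℕ) (lam : ℝ) : ℝ :=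
  ⨆ A : Set ℕ, |prob n (fun T => f T ∈ A) - ∑' k : ℕ, A.indicator (poissonPMF lam) k|

/-- A probability distribution on `ℕ` is nonlattice: the gcd of the differences of
points of its support is `1`. -/
def Nonlattice (p : ℕ → ℝ) : Prop :=
  ∀ h : ℕ, (∀ i j : ℕ, 0 < p i → 0 < p j → (h : ℤ) ∣ (i : ℤ) - (j : ℤ)) → h = 1

/-- The partition function `P(|𝒯_p| = n)` of a Galton–Watson tree with offspring
distribution `p`. -/
noncomputable def gwZ (p : ℕ → ℝ) (n : ℕ) : ℝ :=
  ∑' T : PlaneTree, if PlaneTree.size T = n then piDist p T else 0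

/-- `P(𝒯_{p,n} ∈ {T | P T})` for the conditioned Galton–Watson tree `𝒯_{p,n}`. -/
noncomputable def probGW (p : ℕ → ℝ) (n : ℕ) (P : PlaneTree → Prop) : ℝ :=
  (∑' T : PlaneTree, if PlaneTree.size T = n ∧ P T then piDist p T else 0) / gwZ p n

/-- The expectation `E[f(𝒯_{p,n})]` for an `ℕ`-valued functional. -/
noncomputable def expectGW (p : ℕ → ℝ) (n : ℕ) (f : PlaneTree → ℕ) : ℝ :=
  ∑' k : ℕ, (k : ℝ) * probGW p n (fun T => f T = k)

/-- The filter `n → ∞` along the sizes `n` for which the conditioning `|𝒯_p| = n`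
is well defined. -/
noncomputable def gwFilter (p : ℕ → ℝ) : Filter ℕ :=
  atTop ⊓ Filter.principal {n | 0 < gwZ p n}

/-- A positive function on the positive reals is slowly varying at infinity. -/
def SlowlyVarying (L : ℝ → ℝ) : Prop :=
  (∀ x : ℝ, 0 < x → 0 < L x) ∧
  ∀ c : ℝ, 0 < c → Tendsto (fun x : ℝ => L (c * x) / L x) atTop (𝓝 1)

/-- The probability that a uniformly random permutation of `Fin n` satisfies `P`. -/
noncomputable def probPerm {n : ℕ} (P : Equiv.Perm (Fin n) → Prop) : ℝ :=
  ((Finset.univ.filter P).card : ℝ) / ((Finset.univ : Finset (Equiv.Perm (Fin n))).card : ℝ)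

/-- `S_m = ∑_{i=1}^m d_{τ(i)}`: the sum of `m` of the values `d`, drawn without
replacement via the permutation `τ`. -/
def sampleSum {n : ℕ} (d : Fin n → ℤ) (m : ℕ) (τ : Equiv.Perm (Fin n)) : ℤ :=
  ∑ i : Fin n, if (i : ℕ) < m then d (τ i) else 0

/-- The mean `d̄` of the values `d`. -/
noncomputable def dbar {n : ℕ} (d : Fin n → ℤ) : ℝ := (∑ i : Fin n, (d i : ℝ)) / n

/-- `Q = ∑_i (d_i − d̄)²`. -/
noncomputable def Qval {n : ℕ} (d : Fin n → ℤ) : ℝ := ∑ i : Fin n, ((d i : ℝ) - dbar d) ^ 2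

/-- `σ̂² = (m/n)(1 − m/n) Q`. -/
noncomputable def sigHatSq {n : ℕ} (d : Fin n → ℤ) (m : ℕ) : ℝ :=
  ((m : ℝ) / n) * (1 - (m : ℝ) / n) * Qval d

/-- The empirical frequency `p_k(d) = #{i : d_i = k}/n`. -/
noncomputable def empFreq {n : ℕ} (d : Fin n → ℤ) (k : ℤ) : ℝ :=
  ((Finset.univ.filter (fun i => d i = k)).card : ℝ) / n

/-- The characteristic function `φ_{S_m}(t) = E[exp(i t S_m)]` of the sample sum. -/
noncomputable def charFn {n : ℕ} (d : Fin n → ℤ) (m : ℕ) (t : ℝ) : ℂ :=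
  (Fintype.card (Equiv.Perm (Fin n)) : ℂ)⁻¹ *
    ∑ τ : Equiv.Perm (Fin n), Complex.exp (Complex.I * t * (sampleSum d m τ : ℂ))

/-- A probability distribution on `ℤ` is nonlattice. -/
def NonlatticeZ (p : ℤ → ℝ) : Prop :=
  ∀ h : ℕ, (∀ i j : ℤ, 0 < p i → 0 < p j → (h : ℤ) ∣ i - j) → h = 1

namespace PlaneTree

theorem fringeList_append (F G : List PlaneTree) :
    fringeList (F ++ G) = fringeList F ++ fringeList G := by
  induction F with
  | nil => simp [fringeList]
  | cons T F ih => simp [fringeList, ih]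

/-- The degree statistic of a forest. -/
noncomputable def forestStat (F : List PlaneTree) : ℕ →₀ ℕ :=
  Multiset.toFinsupp (((fringeList F).map degree : List ℕ) : Multiset ℕ)

/-- The number of fringe trees equal to `T'` in a forest. -/
noncomputable def forestCount (T' : PlaneTree) (F : List PlaneTree) : ℕ :=
  ((fringeList F).filter fun t => decide (t = T')).length

@[simp] theorem forestStat_nil : forestStat [] = 0 := by simp [forestStat, fringeList]

@[simp] theorem forestCount_nil (T' : PlaneTree) : forestCount T' [] = 0 := by
  simp [forestCount, fringeList]

theorem forestStat_append (F G : List PlaneTree) :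
    forestStat (F ++ G) = forestStat F + forestStat G := by
  simp [forestStat, fringeList_append, ← Multiset.coe_add]

theorem forestStat_cons (T : PlaneTree) (F : List PlaneTree) :
    forestStat (T :: F) = degStat T + forestStat F := by
  simp [forestStat, degStat, fringeList, ← Multiset.coe_add]

theorem forestCount_append (T' : PlaneTree) (F G : List PlaneTree) :
    forestCount T' (F ++ G) = forestCount T' F + forestCount T' G := by
  simp [forestCount, fringeList_append]

theorem forestCount_cons (T' T : PlaneTree) (F : List PlaneTree) :
    forestCount T' (T :: F) = countTree T' T + forestCount T' F := by
  simp [forestCount, countTree, fringeList]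

theorem degStat_node (ts : List PlaneTree) :
    degStat (node ts) = Finsupp.single ts.length 1 + forestStat ts := by
  rw [degStat, fringe, List.map_cons, ← Multiset.cons_coe, ← Multiset.singleton_add, map_add,
    Multiset.toFinsupp_singleton]
  rfl

theorem countTree_node (T' : PlaneTree) (ts : List PlaneTree) :
    countTree T' (node ts) = (if node ts = T' then 1 else 0) + forestCount T' ts := by
  rw [countTree, fringe, List.filter_cons]
  split_ifs <;> simp_all [forestCount, add_comm]

/-- Induction on forests, removing the root of the first tree. -/
theorem forest_induction {P : List PlaneTree → Prop} (nil : P [])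
    (cons : ∀ ts F, P (ts ++ F) → P (node ts :: F)) (F : List PlaneTree) : P F := by
  induction h : (fringeList F).length using Nat.strong_induction_on generalizing F with
  | _ N ih =>
    match F with
    | [] => exact nil
    | node ts :: F =>
      refine cons ts F (ih _ ?_ _ rfl)
      rw [← h]
      simp [fringeList, fringe, fringeList_append]

theorem forestStat_node_cons (ts F : List PlaneTree) :
    forestStat (node ts :: F) = Finsupp.single ts.length 1 + forestStat (ts ++ F) := by
  rw [forestStat_cons, degStat_node, forestStat_append, add_assoc]

theorem forestCount_node_cons (T' : PlaneTree) (ts F : List PlaneTree) :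
    forestCount T' (node ts :: F) =
      (if node ts = T' then 1 else 0) + forestCount T' (ts ++ F) := by
  rw [forestCount_cons, countTree_node, forestCount_append, add_assoc]

theorem size_le_of_mem_fringeList {t : PlaneTree} (F : List PlaneTree) :
    t ∈ fringeList F → size t ≤ (fringeList F).length := by
  induction F using forest_induction with
  | nil => simp [fringeList]
  | cons ts F ih =>
    intro h
    simp only [fringeList_append, List.mem_append, List.length_append] at ih
    simp only [fringeList, fringe, List.cons_append, List.mem_cons, List.mem_append,
      List.length_cons, List.length_append] at h ⊢
    rcases h with h | h
    · rw [h, size, fringe, List.length_cons]; omega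
    · have := ih h; omega

theorem forestCount_self (ts : List PlaneTree) : forestCount (node ts) ts = 0 := by
  rw [forestCount, List.length_eq_zero_iff, List.filter_eq_nil_iff]
  intro t ht
  simp only [decide_eq_true_eq]
  rintro rfl
  have := size_le_of_mem_fringeList ts ht
  rw [size, fringe, List.length_cons] at this
  omega

theorem forestCount_node_cons_self (ts F : List PlaneTree) :
    forestCount (node ts) (node ts :: F) = forestCount (node ts) F + 1 := by
  rw [forestCount_cons, countTree_node, forestCount_self, if_pos rfl]; ring

theorem forestCount_smul_le (T' : PlaneTree) (F : List PlaneTree) :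
    forestCount T' F • degStat T' ≤ forestStat F := by
  suffices ∀ N F, (fringeList F).length ≤ N → forestCount T' F • degStat T' ≤ forestStat F from
    this _ F le_rfl
  intro N
  induction N with
  | zero =>
    intro F hF
    match F with
    | [] => simp
    | node ts :: F => simp [fringeList, fringe] at hF
  | succ N ih =>
    intro F hF
    match F with
    | [] => simp
    | node ts :: F =>
      simp only [fringeList, fringe, List.cons_append, List.length_cons, List.length_append] at hF
      by_cases h : node ts = T'
      · subst h
        rw [forestCount_node_cons_self, forestStat_cons, add_smul, one_smul, add_comm]
        gcongr
        exact ih F (by omega)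
      · rw [forestCount_node_cons, if_neg h, zero_add, forestStat_node_cons]
        refine (ih (ts ++ F) ?_).trans le_add_self
        rw [fringeList_append, List.length_append]; omega

end PlaneTree

open PlaneTree

theorem nsize_add (a b : ℕ →₀ ℕ) : nsize (a + b) = nsize a + nsize b :=
  Finsupp.sum_add_index' (fun _ => rfl) fun _ _ _ => rfl

@[simp] theorem nsize_single (i c : ℕ) : nsize (Finsupp.single i c) = c := by simp [nsize]

@[simp] theorem nsize_zero : nsize 0 = 0 := by simp [nsize]

theorem nsize_eq_zero {a : ℕ →₀ ℕ} : nsize a = 0 ↔ a = 0 := by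
  refine ⟨fun h => ?_, fun h => by simp [h]⟩
  ext i
  by_contra hi
  have := Finset.sum_eq_zero_iff.1 h i (Finsupp.mem_support_iff.2 hi)
  exact hi this

theorem nsize_smul (q : ℕ) (a : ℕ →₀ ℕ) : nsize (q • a) = q * nsize a := by
  induction q with
  | zero => simp
  | succ q ih => rw [add_smul, one_smul, nsize_add, ih]; ring

theorem apply_le_nsize (a : ℕ →₀ ℕ) (i : ℕ) : a i ≤ nsize a := by
  by_cases h : i ∈ a.support
  · exact Finset.single_le_sum (f := fun i => a i) (fun _ _ => Nat.zero_le _) h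
  · simp [Finsupp.notMem_support_iff.1 h]

/-- The total outdegree `∑ i·n(i)` of a degree statistic. -/
def totalDegree (n : ℕ →₀ ℕ) : ℕ := n.sum fun i c => i * c

theorem totalDegree_add (a b : ℕ →₀ ℕ) :
    totalDegree (a + b) = totalDegree a + totalDegree b :=
  Finsupp.sum_add_index' (fun _ => rfl) fun _ _ _ => Nat.mul_add _ _ _

@[simp] theorem totalDegree_single (i c : ℕ) : totalDegree (Finsupp.single i c) = i * c := by
  simp [totalDegree]

@[simp] theorem totalDegree_zero : totalDegree 0 = 0 := by simp [totalDegree]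

theorem totalDegree_smul (q : ℕ) (a : ℕ →₀ ℕ) : totalDegree (q • a) = q * totalDegree a := by
  induction q with
  | zero => simp
  | succ q ih => rw [add_smul, one_smul, totalDegree_add, ih]; ring

theorem nsize_forestStat (F : List PlaneTree) :
    nsize (forestStat F) = F.length + totalDegree (forestStat F) := by
  induction F using forest_induction with
  | nil => simp
  | cons ts F ih =>
    rw [forestStat_node_cons, nsize_add, totalDegree_add, ih]
    simp; ring

theorem degStat_eq_forestStat (T : PlaneTree) : degStat T = forestStat [T] := by
  simp [forestStat_cons]

theorem nsize_degStat (T : PlaneTree) : nsize (degStat T) = 1 + totalDegree (degStat T) := by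
  rw [degStat_eq_forestStat, nsize_forestStat]; rfl

theorem nsize_degStat_eq_size (T : PlaneTree) : nsize (degStat T) = size T := by
  have : nsize (degStat T) = ((fringe T).map degree).length := by
    unfold nsize degStat
    have := Multiset.toFinsupp_sum_eq (((fringe T).map degree : List ℕ) : Multiset ℕ)
    rw [Multiset.coe_card] at this
    exact this
  rw [this, List.length_map, size]

/-- All forests of `k` trees with degree statistic `n`, when `N` is the size of `n`. -/
noncomputable def forests : ℕ → ℕ → (ℕ →₀ ℕ) → Finset (List PlaneTree)
  | 0, 0, n => if n = 0 then {[]} else ∅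
  | 0, _ + 1, _ => ∅
  | _ + 1, 0, _ => ∅
  | N + 1, k + 1, n => n.support.biUnion fun i =>
      (forests N (k + i) (n - Finsupp.single i 1)).image
        fun F => PlaneTree.node (F.take i) :: F.drop i

theorem single_add_tsub {n : ℕ →₀ ℕ} {i : ℕ} (h : i ∈ n.support) :
    Finsupp.single i 1 + (n - Finsupp.single i 1) = n := by
  refine add_tsub_cancel_of_le ?_
  rw [Finsupp.single_le_iff]
  exact Nat.one_le_iff_ne_zero.2 (Finsupp.mem_support_iff.1 h)

theorem mem_forests {N k : ℕ} {n : ℕ →₀ ℕ} {F : List PlaneTree} :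
    F ∈ forests N k n ↔ F.length = k ∧ forestStat F = n ∧ nsize n = N := by
  induction N generalizing k n F with
  | zero =>
    cases k with
    | zero =>
      rw [forests]
      split_ifs with h
      · subst h
        simp only [Finset.mem_singleton, nsize_zero, and_true, List.length_eq_zero_iff]
        exact ⟨fun h => by simp [h], fun h => h.1⟩
      · simp only [Finset.notMem_empty, nsize_eq_zero, false_iff]; tauto
    | succ k =>
      simp only [forests, Finset.notMem_empty, nsize_eq_zero, false_iff]
      rintro ⟨h1, h2, h3⟩
      have := nsize_forestStat F
      rw [h2, h3] at this
      simp at this; omega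
  | succ N ih =>
    cases k with
    | zero =>
      simp only [forests, Finset.notMem_empty, false_iff]
      rintro ⟨h1, h2, h3⟩
      rw [List.length_eq_zero_iff] at h1
      subst h1
      simp at h2; subst h2; simp at h3
    | succ k =>
      simp only [forests, Finset.mem_biUnion, Finset.mem_image, ih]
      constructor
      · rintro ⟨i, hi, F, ⟨h1, h2, h3⟩, rfl⟩
        have hs := single_add_tsub hi
        refine ⟨by simp [h1], ?_, ?_⟩
        · rw [forestStat_node_cons, List.take_append_drop, h2, List.length_take, h1,
            Nat.min_eq_left (by omega), hs]
        · rw [← hs, nsize_add, h3, nsize_single, add_comm]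
      · rintro ⟨h1, h2, h3⟩
        match F with
        | [] => simp at h1
        | PlaneTree.node ts :: F =>
          rw [forestStat_node_cons] at h2
          have hn : n - Finsupp.single ts.length 1 = forestStat (ts ++ F) := by
            rw [← h2, add_tsub_cancel_left]
          refine ⟨ts.length, ?_, ts ++ F, ⟨?_, hn.symm, ?_⟩, by simp⟩
          · rw [Finsupp.mem_support_iff, ← h2]; simp
          · simp at h1 ⊢; omega
          · rw [hn]
            rw [← h2, nsize_add, nsize_single] at h3; omega

/-- Decomposition of a sum over forests according to the degree of the first root. -/
theorem sum_forests_succ {M : Type*} [AddCommMonoid M] (N k : ℕ) (n : ℕ →₀ ℕ)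
    (g : List PlaneTree → M) :
    ∑ F ∈ forests (N + 1) (k + 1) n, g F = ∑ i ∈ n.support,
      ∑ F ∈ forests N (k + i) (n - Finsupp.single i 1),
        g (PlaneTree.node (F.take i) :: F.drop i) := by
  rw [forests, Finset.sum_biUnion]
  · refine Finset.sum_congr rfl fun i _ => Finset.sum_image fun F _ F' _ h => ?_
    simp only [List.cons.injEq, PlaneTree.node.injEq] at h
    rw [← List.take_append_drop i F, ← List.take_append_drop i F', h.1, h.2]
  · intro i _ j _ hij
    rw [Function.onFun, Finset.disjoint_left]
    rintro _ h h'
    obtain ⟨F, hF, rfl⟩ := Finset.mem_image.1 h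
    obtain ⟨F', hF', h⟩ := Finset.mem_image.1 h'
    simp only [List.cons.injEq, PlaneTree.node.injEq] at h
    have := congrArg List.length h.1
    rw [List.length_take, List.length_take, (mem_forests.1 hF).1, (mem_forests.1 hF').1] at this
    omega

/-- The sum of `binom(N_{T'}(F), q)` over all forests `F` of `k` trees with degree
statistic `n`. -/
noncomputable def chooseSum (T' : PlaneTree) (q k : ℕ) (n : ℕ →₀ ℕ) : ℕ :=
  ∑ F ∈ forests (nsize n) k n, (forestCount T' F).choose q

theorem chooseSum_eq_zero {T' : PlaneTree} {q k : ℕ} {n : ℕ →₀ ℕ} (h : ¬ q • degStat T' ≤ n) :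
    chooseSum T' q k n = 0 := by
  refine Finset.sum_eq_zero fun F hF => Nat.choose_eq_zero_of_lt ?_
  by_contra! hq
  refine h (le_trans ?_ (forestCount_smul_le T' F |>.trans_eq (mem_forests.1 hF).2.1))
  gcongr

theorem sum_choose_tail (T' : PlaneTree) (q k : ℕ) (n : ℕ →₀ ℕ) (h : degStat T' ≤ n) :
    ∑ F ∈ forests (nsize n) (k + 1) n,
      (if F.head? = some T' then (forestCount T' F.tail).choose q else 0) =
      chooseSum T' q k (n - degStat T') := by
  rw [← Finset.sum_filter, chooseSum]
  symm
  obtain ⟨a, rfl⟩ := exists_add_of_le h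
  rw [add_tsub_cancel_left]
  refine Finset.sum_bij' (fun F _ => T' :: F) (fun F _ => F.tail) ?_ ?_ ?_ ?_ ?_
  · intro F hF
    simp only [Finset.mem_filter, mem_forests] at hF ⊢
    simp [hF.1, hF.2.1, forestStat_cons]
  · intro F hF
    simp only [Finset.mem_filter, mem_forests] at hF ⊢
    obtain ⟨⟨h1, h2, h3⟩, h4⟩ := hF
    match F with
    | [] => simp at h1
    | T :: F =>
      simp only [List.head?_cons, Option.some.injEq] at h4
      subst h4
      rw [forestStat_cons] at h2
      simp only [List.length_cons, Nat.add_right_cancel_iff] at h1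
      exact ⟨h1, add_left_cancel h2, trivial⟩
  · intro F hF; rfl
  · intro F hF
    simp only [Finset.mem_filter] at hF
    match F with
    | [] => simp at hF
    | T :: F => simp at hF ⊢; exact hF.2.symm
  · intro F hF; rfl

theorem nsize_pos_iff {n : ℕ →₀ ℕ} : 0 < nsize n ↔ n ≠ 0 := by
  rw [Nat.pos_iff_ne_zero, Ne, nsize_eq_zero]

theorem nsize_tsub_single {n : ℕ →₀ ℕ} {i : ℕ} (hi : i ∈ n.support) :
    nsize (n - Finsupp.single i 1) + 1 = nsize n := by
  conv_rhs => rw [← single_add_tsub hi, nsize_add, nsize_single]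
  ring

theorem chooseSum_zero_succ (T' : PlaneTree) (k : ℕ) (n : ℕ →₀ ℕ) :
    chooseSum T' 0 (k + 1) n =
      ∑ i ∈ n.support, chooseSum T' 0 (k + i) (n - Finsupp.single i 1) := by
  rcases eq_or_ne n 0 with rfl | hn
  · simp [chooseSum, forests]
  obtain ⟨N, hN⟩ := Nat.exists_eq_succ_of_ne_zero (nsize_pos_iff.2 hn).ne'
  rw [chooseSum, hN, Nat.succ_eq_add_one, sum_forests_succ]
  refine Finset.sum_congr rfl fun i hi => ?_
  have := nsize_tsub_single hi
  rw [chooseSum, show nsize (n - Finsupp.single i 1) = N by omega]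
  simp

theorem choose_forestCount_succ (T' : PlaneTree) (q : ℕ) (ts F : List PlaneTree) :
    (forestCount T' (PlaneTree.node ts :: F)).choose (q + 1) =
      (forestCount T' (ts ++ F)).choose (q + 1) +
        if (PlaneTree.node ts :: F).head? = some T'
          then (forestCount T' (PlaneTree.node ts :: F).tail).choose q else 0 := by
  simp only [List.head?_cons, Option.some.injEq, List.tail_cons]
  rw [forestCount_node_cons]
  split_ifs with h
  · subst h
    rw [forestCount_append, forestCount_self, zero_add, add_comm, Nat.choose_succ_succ, add_comm]
  · simp

theorem chooseSum_succ_succ (T' : PlaneTree) (q k : ℕ) (n : ℕ →₀ ℕ) (h : degStat T' ≤ n) :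
    chooseSum T' (q + 1) (k + 1) n =
      ∑ i ∈ n.support, chooseSum T' (q + 1) (k + i) (n - Finsupp.single i 1) +
        chooseSum T' q k (n - degStat T') := by
  rcases eq_or_ne n 0 with rfl | hn
  · have := nsize_degStat T'
    rw [nonpos_iff_eq_zero] at h
    rw [h] at this
    simp at this
  obtain ⟨N, hN⟩ := Nat.exists_eq_succ_of_ne_zero (nsize_pos_iff.2 hn).ne'
  have key := sum_forests_succ N k n fun F =>
    if F.head? = some T' then (forestCount T' F.tail).choose q else 0
  rw [← Nat.succ_eq_add_one N, ← hN, sum_choose_tail T' q k n h] at key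
  rw [key, chooseSum, hN, Nat.succ_eq_add_one, sum_forests_succ, ← Finset.sum_add_distrib]
  refine Finset.sum_congr rfl fun i hi => ?_
  have := nsize_tsub_single hi
  rw [chooseSum, show nsize (n - Finsupp.single i 1) = N by omega, ← Finset.sum_add_distrib]
  refine Finset.sum_congr rfl fun F _ => ?_
  rw [choose_forestCount_succ, List.take_append_drop]

/-- The product of the factorials of the entries of a degree statistic. -/
def factorialProd (n : ℕ →₀ ℕ) : ℕ := n.prod fun _ c => c.factorial

theorem factorialProd_pos (n : ℕ →₀ ℕ) : 0 < factorialProd n :=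
  Finset.prod_pos fun _ _ => Nat.factorial_pos _

theorem factorialProd_tsub_single {n : ℕ →₀ ℕ} {i : ℕ} (hi : i ∈ n.support) :
    factorialProd n = n i * factorialProd (n - Finsupp.single i 1) := by
  have h0 : ∀ a : ℕ →₀ ℕ, factorialProd a = (a i).factorial * factorialProd (a.erase i) :=
    fun a => (Finsupp.mul_prod_erase' a i (fun _ c => c.factorial) fun _ => rfl).symm
  have he : (n - Finsupp.single i 1).erase i = n.erase i := by
    ext j
    by_cases hj : j = i
    · simp [hj]
    · simp [Finsupp.erase_ne hj, Ne.symm hj]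
  rw [h0 n, h0 (n - _), he, ← mul_assoc]
  congr 1
  simp only [Finsupp.coe_tsub, Pi.sub_apply, Finsupp.single_eq_same]
  exact (Nat.mul_factorial_pred (Finsupp.mem_support_iff.1 hi)).symm

theorem chooseSum_zero_left (T' : PlaneTree) (q : ℕ) (n : ℕ →₀ ℕ) (h : 1 ≤ nsize n + q) :
    chooseSum T' q 0 n = 0 := by
  refine Finset.sum_eq_zero fun F hF => ?_
  obtain ⟨h1, h2, h3⟩ := mem_forests.1 hF
  rw [List.length_eq_zero_iff] at h1
  subst h1
  rw [forestStat_nil] at h2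
  subst h2
  rw [nsize_zero, zero_add] at h
  rw [forestCount_nil]
  exact Nat.choose_eq_zero_of_lt h

theorem totalDegree_eq_sum (n : ℕ →₀ ℕ) : totalDegree n = ∑ i ∈ n.support, i * n i := rfl

theorem nsize_eq_sum (n : ℕ →₀ ℕ) : nsize n = ∑ i ∈ n.support, n i := rfl

theorem chooseSum_zero_zero (T' : PlaneTree) : chooseSum T' 0 0 0 = 1 := by
  simp [chooseSum, forests]

/-- Reduction of a sum over a degree statistic to the part that remains after removing `q`
copies of a tree `T'` from it. -/
theorem sum_chooseSum_eq (T' : PlaneTree) (q k : ℕ) (a : ℕ →₀ ℕ) :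
    ∑ i ∈ (a + q • degStat T').support,
        chooseSum T' q (k + i) (a + q • degStat T' - Finsupp.single i 1) =
      ∑ i ∈ a.support, chooseSum T' q (k + i) (a - Finsupp.single i 1 + q • degStat T') := by
  symm
  have hsub : a.support ⊆ (a + q • degStat T').support := fun i hi => by
    rw [Finsupp.mem_support_iff] at hi ⊢
    simp only [Finsupp.coe_add, Pi.add_apply]; omega
  rw [← Finset.sum_subset hsub]
  · refine Finset.sum_congr rfl fun i hi => ?_
    rw [tsub_add_eq_add_tsub]
    rw [Finsupp.single_le_iff]
    exact Nat.one_le_iff_ne_zero.2 (Finsupp.mem_support_iff.1 hi)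
  · intro i hi hia
    refine chooseSum_eq_zero fun h => ?_
    rw [Finsupp.mem_support_iff] at hi
    rw [Finsupp.notMem_support_iff] at hia
    have := h i
    simp only [Finsupp.coe_add, Pi.add_apply, Finsupp.coe_tsub, Pi.sub_apply,
      Finsupp.single_eq_same, hia, zero_add] at this hi
    omega

/-- The exact formula for the binomial moments of the number of fringe trees equal to a given
tree. -/
theorem chooseSum_formula (T' : PlaneTree) (q k : ℕ) (a : ℕ →₀ ℕ) (h1 : 1 ≤ nsize a + q)
    (h2 : nsize a + q = k + totalDegree a) :
    chooseSum T' q k (a + q • degStat T') * (q.factorial * factorialProd a) =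
      k * (nsize a + q - 1).factorial := by
  induction hs : nsize a + q generalizing q k a with
  | zero => omega
  | succ s ih =>
  cases k with
  | zero =>
    rw [chooseSum_zero_left, zero_mul, zero_mul]
    rw [nsize_add, nsize_smul, nsize_degStat, mul_add]; omega
  | succ k =>
  have step : ∀ i ∈ a.support, 1 ≤ s →
      chooseSum T' q (k + i) (a - Finsupp.single i 1 + q • degStat T') *
        (q.factorial * factorialProd a) = a i * ((k + i) * (s - 1).factorial) := by
    intro i hi hs1
    have e1 := nsize_tsub_single hi
    have e2 : totalDegree (a - Finsupp.single i 1) + i = totalDegree a := by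
      conv_rhs => rw [← single_add_tsub hi, totalDegree_add, totalDegree_single]
      ring
    rw [← ih q (k + i) (a - Finsupp.single i 1) (by omega) (by omega) (by omega),
      factorialProd_tsub_single hi]
    ring
  have hsum : ∑ i ∈ a.support, a i * ((k + i) * (s - 1).factorial) =
      (k * nsize a + totalDegree a) * (s - 1).factorial := by
    rw [totalDegree_eq_sum, nsize_eq_sum, Finset.mul_sum, ← Finset.sum_add_distrib,
      Finset.sum_mul]
    exact Finset.sum_congr rfl fun i _ => by ring
  cases q with
  | zero =>
    rcases Nat.eq_zero_or_pos s with rfl | hs1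
    · have hk : k = 0 := by omega
      have hd : totalDegree a = 0 := by omega
      subst hk
      have ha : a = Finsupp.single 0 1 := by
        rw [totalDegree_eq_sum, Finset.sum_eq_zero_iff] at hd
        have h3 : ∀ i, i ≠ 0 → a i = 0 := fun i hi => by
          by_contra h
          have := hd i (Finsupp.mem_support_iff.2 h)
          simp [hi, h] at this
        have h4 : a = Finsupp.single 0 (a 0) := by
          ext i
          by_cases hi : i = 0
          · simp [hi]
          · rw [h3 i hi, Finsupp.single_apply, if_neg (Ne.symm hi)]
        rw [h4, nsize_single] at hs
        rw [h4, show a 0 = 1 by simpa using hs]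
      subst ha
      rw [zero_smul, add_zero, chooseSum_zero_succ]
      simp only [Finsupp.support_single _ one_ne_zero, Finset.sum_singleton, tsub_self, add_zero,
        chooseSum_zero_zero]
      simp [factorialProd, Finsupp.prod]
    · rw [chooseSum_zero_succ, sum_chooseSum_eq, Finset.sum_mul,
        Finset.sum_congr rfl fun i hi => step i hi hs1, hsum]
      obtain ⟨s, rfl⟩ := Nat.exists_eq_succ_of_ne_zero hs1.ne'
      have : nsize a = s + 2 := by omega
      have h5 : totalDegree a = s + 1 - k := by omega
      simp only [Nat.succ_eq_add_one, Nat.add_sub_cancel, Nat.factorial_succ]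
      rw [← mul_assoc, this]
      congr 1
      have : totalDegree a + k = s + 1 := by omega
      linarith
  | succ q =>
    have hle : degStat T' ≤ a + (q + 1) • degStat T' := by
      rw [add_smul, one_smul, ← add_assoc]; exact le_add_self
    have hsub : a + (q + 1) • degStat T' - degStat T' = a + q • degStat T' := by
      rw [add_smul, one_smul, ← add_assoc, add_tsub_cancel_right]
    rw [chooseSum_succ_succ _ _ _ _ hle, sum_chooseSum_eq, hsub, add_mul, Finset.sum_mul]
    rcases Nat.eq_zero_or_pos s with rfl | hs1
    · have hq : q = 0 := by omega
      have ha : a = 0 := nsize_eq_zero.1 (by omega)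
      have hk : k = 0 := by omega
      subst hq ha hk
      simp [chooseSum_zero_zero, factorialProd]
    · rw [Finset.sum_congr rfl fun i hi => step i hi hs1, hsum, Nat.factorial_succ,
        show chooseSum T' q k (a + q • degStat T') * ((q + 1) * q.factorial * factorialProd a) =
          (q + 1) * (chooseSum T' q k (a + q • degStat T') * (q.factorial * factorialProd a)) by
          ring, ih q k a (by omega) (by omega) (by omega)]
      obtain ⟨s, rfl⟩ := Nat.exists_eq_succ_of_ne_zero hs1.ne'
      simp only [Nat.succ_eq_add_one, Nat.add_sub_cancel, Nat.factorial_succ]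
      have e1 : nsize a + q = s + 1 := by omega
      have e2 : totalDegree a + k = s + 1 := by omega
      have : k * nsize a + totalDegree a + (q + 1) * k = (k + 1) * (s + 1) := by
        calc _ = k * (nsize a + q) + (totalDegree a + k) := by ring
          _ = _ := by rw [e1, e2]; ring
      rw [← mul_assoc (k + 1), ← this]; ring

theorem finite_treesWith (n : ℕ →₀ ℕ) : (treesWith n).Finite := by
  refine Set.Finite.of_finite_image (f := fun T => [T])
    ((forests (nsize n) 1 n).finite_toSet.subset ?_) fun _ _ _ _ h => by simpa using h
  rintro _ ⟨T, hT, rfl⟩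
  rw [Finset.mem_coe, mem_forests, ← degStat_eq_forestStat]
  exact ⟨rfl, hT, rfl⟩

/-- The finset of plane trees with degree statistic `n`. -/
noncomputable def treeFinset (n : ℕ →₀ ℕ) : Finset PlaneTree := (finite_treesWith n).toFinset

theorem mem_treeFinset {n : ℕ →₀ ℕ} {T : PlaneTree} : T ∈ treeFinset n ↔ degStat T = n := by
  rw [treeFinset, Set.Finite.mem_toFinset, treesWith, Set.mem_ofPred_eq]

theorem sum_treeFinset {M : Type*} [AddCommMonoid M] (n : ℕ →₀ ℕ) (g : List PlaneTree → M) :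
    ∑ T ∈ treeFinset n, g [T] = ∑ F ∈ forests (nsize n) 1 n, g F := by
  refine Finset.sum_bij (fun T _ => [T]) (fun T hT => ?_) (fun _ _ _ _ h => by simpa using h)
    (fun F hF => ?_) fun _ _ => rfl
  · rw [mem_forests, ← degStat_eq_forestStat]
    exact ⟨rfl, mem_treeFinset.1 hT, rfl⟩
  · obtain ⟨h1, h2, -⟩ := mem_forests.1 hF
    obtain ⟨T, rfl⟩ := List.length_eq_one_iff.1 h1
    exact ⟨T, mem_treeFinset.2 (by rw [degStat_eq_forestStat, h2]), rfl⟩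

theorem forestCount_singleton (T' T : PlaneTree) : forestCount T' [T] = countTree T' T := by
  rw [forestCount_cons, forestCount_nil, add_zero]

theorem sum_choose_countTree (T' : PlaneTree) (q : ℕ) (n : ℕ →₀ ℕ) :
    ∑ T ∈ treeFinset n, (countTree T' T).choose q = chooseSum T' q 1 n := by
  rw [chooseSum, ← sum_treeFinset]
  simp only [forestCount_singleton]

theorem countTree_le_nsize {T' T : PlaneTree} {n : ℕ →₀ ℕ} (h : T ∈ treeFinset n) :
    countTree T' T ≤ nsize n := by
  rw [← mem_treeFinset.1 h, nsize_degStat_eq_size]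
  exact List.length_filter_le _ _

/-- The expectation of a real-valued functional of the uniformly random tree with degree
statistic `n`. -/
noncomputable def mean (n : ℕ →₀ ℕ) (g : PlaneTree → ℝ) : ℝ :=
  (∑ T ∈ treeFinset n, g T) / ((treeFinset n).card : ℝ)

theorem numTrees_eq (n : ℕ →₀ ℕ) : numTrees n = (treeFinset n).card :=
  Set.ncard_eq_toFinset_card _ (finite_treesWith n)

theorem prob_eq_mean (n : ℕ →₀ ℕ) (P : PlaneTree → Prop) :
    prob n P = mean n fun T => if P T then 1 else 0 := by
  have : {T ∈ treesWith n | P T} = ((treeFinset n).filter P : Set PlaneTree) := by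
    ext T
    simp [mem_treeFinset, treesWith]
  rw [prob, numTrees_eq, this, Set.ncard_coe_finset, mean, Finset.sum_boole]

theorem mean_add (n : ℕ →₀ ℕ) (f g : PlaneTree → ℝ) :
    mean n (fun T => f T + g T) = mean n f + mean n g := by
  rw [mean, Finset.sum_add_distrib, add_div]; rfl

theorem mean_const_mul (n : ℕ →₀ ℕ) (c : ℝ) (f : PlaneTree → ℝ) :
    mean n (fun T => c * f T) = c * mean n f := by
  rw [mean, ← Finset.mul_sum, mul_div_assoc]; rfl

theorem mean_sum {ι : Type*} (n : ℕ →₀ ℕ) (s : Finset ι) (f : ι → PlaneTree → ℝ) :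
    mean n (fun T => ∑ i ∈ s, f i T) = ∑ i ∈ s, mean n (f i) := by
  simp only [mean]
  rw [Finset.sum_comm, Finset.sum_div]

theorem mean_mono (n : ℕ →₀ ℕ) {f g : PlaneTree → ℝ} (h : ∀ T ∈ treeFinset n, f T ≤ g T) :
    mean n f ≤ mean n g := by
  unfold mean
  gcongr with T hT
  exact h T hT

theorem abs_mean_le (n : ℕ →₀ ℕ) (f : PlaneTree → ℝ) : |mean n f| ≤ mean n fun T => |f T| := by
  rw [mean, mean, abs_div, Nat.abs_cast]
  gcongr
  exact Finset.abs_sum_le_sum_abs _ _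

theorem expect_eq_mean (n : ℕ →₀ ℕ) (f : PlaneTree → ℕ) :
    expect n f = mean n fun T => (f T : ℝ) := by
  rw [expect, tsum_eq_sum (s := (treeFinset n).image f)]
  · simp only [prob_eq_mean, ← mean_const_mul]
    rw [← mean_sum]
    unfold mean
    congr 1
    refine Finset.sum_congr rfl fun T hT => ?_
    beta_reduce
    rw [Finset.sum_eq_single (f T)]
    · simp
    · intro b _ hb
      simp [Ne.symm hb]
    · exact fun h => absurd (Finset.mem_image_of_mem f hT) h
  · intro b hb
    rw [prob_eq_mean, mean, Finset.sum_eq_zero, zero_div, mul_zero]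
    intro T hT
    rw [if_neg]
    rintro rfl
    exact hb (Finset.mem_image_of_mem f hT)

/-- `∏ᵢ n(i)(n(i) - 1)⋯(n(i) - s(i) + 1)`. -/
def descProd (n s : ℕ →₀ ℕ) : ℕ := s.prod fun i c => (n i).descFactorial c

theorem factorialProd_add (a s : ℕ →₀ ℕ) :
    factorialProd (a + s) = factorialProd a * descProd (a + s) s := by
  have ha : a.support ⊆ (a + s).support := Finsupp.support_mono le_self_add
  have hs : s.support ⊆ (a + s).support := Finsupp.support_mono le_add_self
  rw [factorialProd, factorialProd, descProd, Finsupp.prod,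
    Finsupp.prod_of_support_subset _ ha _ (by simp),
    Finsupp.prod_of_support_subset _ hs _ (by simp), ← Finset.prod_mul_distrib]
  refine Finset.prod_congr rfl fun i _ => ?_
  rw [← Nat.factorial_mul_descFactorial (show s i ≤ (a + s) i by simp)]
  simp

theorem descProd_eq_zero {n s : ℕ →₀ ℕ} (h : ¬ s ≤ n) : descProd n s = 0 := by
  rw [Finsupp.le_def] at h
  push Not at h
  obtain ⟨i, hi⟩ := h
  refine Finset.prod_eq_zero (i := i) (Finsupp.mem_support_iff.2 (by omega)) ?_
  exact Nat.descFactorial_eq_zero_iff_lt.2 hi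

theorem card_treeFinset (n : ℕ →₀ ℕ) (h : IsDegStat n) :
    (treeFinset n).card * factorialProd n = (nsize n - 1).factorial := by
  have h1 : nsize n = 1 + totalDegree n := h
  have := chooseSum_formula (PlaneTree.node []) 0 1 n (by omega) (by omega)
  rw [← sum_choose_countTree] at this
  simpa using this

theorem mean_choose (T' : PlaneTree) (q : ℕ) (n : ℕ →₀ ℕ) (h : IsDegStat n) :
    mean n (fun T => ((countTree T' T).choose q : ℝ)) * q.factorial *
      (nsize n - 1).descFactorial (q * totalDegree (degStat T')) =
      descProd n (q • degStat T') := by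
  have h1 : nsize n = 1 + totalDegree n := h
  have hm : mean n (fun T => ((countTree T' T).choose q : ℝ)) =
      (chooseSum T' q 1 n : ℝ) / ((treeFinset n).card : ℝ) := by
    rw [mean, ← sum_choose_countTree]; push_cast; rfl
  rw [hm]
  by_cases hle : q • degStat T' ≤ n
  · obtain ⟨a, rfl⟩ := exists_add_of_le hle
    rw [add_comm (q • _) a] at *
    have hT := nsize_degStat T'
    have h2 : nsize a + q = 1 + totalDegree a := by
      rw [nsize_add, nsize_smul, totalDegree_add, totalDegree_smul, hT] at h1
      linarith
    have e1 := chooseSum_formula T' q 1 a (by omega) h2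
    have e2 := card_treeFinset _ h
    have e3 := factorialProd_add a (q • degStat T')
    have e4 : nsize (a + q • degStat T') - 1 - q * totalDegree (degStat T') =
        nsize a + q - 1 := by
      rw [nsize_add, nsize_smul, hT, mul_add]; omega
    have e5 := Nat.factorial_mul_descFactorial (n := nsize (a + q • degStat T') - 1)
      (k := q * totalDegree (degStat T')) (by
        rw [nsize_add, nsize_smul, hT, mul_add]; omega)
    rw [e4] at e5
    have p1 := factorialProd_pos a
    have p2 := factorialProd_pos (a + q • degStat T')
    have p3 : 0 < (treeFinset (a + q • degStat T')).card := by
      refine Nat.pos_of_ne_zero fun h0 => ?_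
      rw [h0, zero_mul] at e2
      exact (Nat.factorial_pos _).ne e2
    rw [one_mul] at e1
    rw [div_mul_eq_mul_div, div_mul_eq_mul_div, div_eq_iff (by positivity)]
    norm_cast
    refine Nat.eq_of_mul_eq_mul_right p1 ?_
    calc _ = chooseSum T' q 1 (a + q • degStat T') * (q.factorial * factorialProd a) *
          (nsize (a + q • degStat T') - 1).descFactorial (q * totalDegree (degStat T')) := by ring
      _ = (treeFinset (a + q • degStat T')).card * factorialProd (a + q • degStat T') := by
        rw [e1, e5, e2]
      _ = _ := by rw [e3]; ring
  · rw [chooseSum_eq_zero hle, descProd_eq_zero hle]; simp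

theorem pow_mul_le_descFactorial (N a : ℕ) (hN : 1 ≤ N) :
    (N : ℝ) ^ a * (1 - (a : ℝ) ^ 2 / N) ≤ (N - 1).descFactorial a := by
  have hN' : (0 : ℝ) < N := by exact_mod_cast hN
  by_cases h : a ≤ N
  · have h1 : (N - a) ^ a ≤ (N - 1).descFactorial a := by
      have := Nat.pow_sub_le_descFactorial (N - 1) a
      rwa [Nat.sub_add_cancel hN] at this
    have h2 : (N : ℝ) ^ a * (1 - (a : ℝ) ^ 2 / N) ≤ ((N : ℝ) - a) ^ a := by
      have h3 : (N : ℝ) - a = N * (1 + -(a / N : ℝ)) := by field_simp; ring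
      rw [h3, mul_pow]
      gcongr
      refine le_trans (le_of_eq ?_) (one_add_mul_le_pow (a := -(a / N : ℝ)) ?_ a)
      · ring
      · have : (a : ℝ) / N ≤ 1 := by
          rw [div_le_one hN']; exact_mod_cast h
        linarith
    refine h2.trans ?_
    rw [← Nat.cast_sub h]
    exact_mod_cast h1
  · refine le_trans (mul_nonpos_of_nonneg_of_nonpos (by positivity) ?_) (Nat.cast_nonneg _)
    rw [sub_nonpos, le_div_iff₀ hN', one_mul]
    push Not at h
    have : (N : ℝ) < a := by exact_mod_cast h
    have h1 : (1 : ℝ) ≤ a := by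
      have : (1 : ℝ) ≤ N := by exact_mod_cast hN
      linarith
    nlinarith

/-- `∏ᵢ n(i) ^ s(i)`. -/
def powProd (n s : ℕ →₀ ℕ) : ℕ := s.prod fun i c => n i ^ c

theorem descProd_le_powProd (n s : ℕ →₀ ℕ) : descProd n s ≤ powProd n s :=
  Finset.prod_le_prod' fun _ _ => Nat.descFactorial_le_pow _ _

theorem powProd_smul (q : ℕ) (n s : ℕ →₀ ℕ) : powProd n (q • s) = powProd n s ^ q := by
  induction q with
  | zero => simp [powProd]
  | succ q ih =>
    rw [add_smul, one_smul, powProd, Finsupp.prod_add_index' (by simp) fun _ _ _ => pow_add _ _ _,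
      pow_succ, ← ih]
    rfl

theorem mul_powProd_le_descProd (n s : ℕ →₀ ℕ) (ν : ℝ) (hν : 0 < ν)
    (h : ∀ i ∈ s.support, ν ≤ n i) :
    (powProd n s : ℝ) * (1 - (nsize s : ℝ) ^ 2 / ν) ≤ descProd n s := by
  by_cases hs : (nsize s : ℝ) ≤ ν
  · have hle : ∀ i ∈ s.support, (n i : ℝ) ^ s i * (1 - nsize s / ν) ^ s i ≤
        (n i).descFactorial (s i) := by
      intro i hi
      have h1 : (s i : ℝ) ≤ nsize s := by exact_mod_cast apply_le_nsize s i
      have h2 := h i hi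
      have h3 : s i ≤ n i := by exact_mod_cast h1.trans (hs.trans h2)
      have h4 : (n i - s i) ^ s i ≤ (n i).descFactorial (s i) :=
        le_trans (Nat.pow_le_pow_left (by omega) _) (Nat.pow_sub_le_descFactorial _ _)
      rw [← mul_pow]
      refine le_trans ?_ (Nat.cast_le.2 h4)
      push_cast [h3]
      have h5 : 0 ≤ 1 - nsize s / ν := by
        rw [sub_nonneg, div_le_one hν]; exact hs
      gcongr
      rw [mul_sub, mul_one]
      gcongr
      rw [mul_div_assoc', le_div_iff₀ hν]
      nlinarith [Nat.cast_nonneg (α := ℝ) (s i)]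
    have hp : (powProd n s : ℝ) * (1 - nsize s / ν) ^ nsize s ≤ descProd n s := by
      have hpow : (1 - nsize s / ν) ^ nsize s = ∏ i ∈ s.support, (1 - nsize s / ν) ^ s i :=
        (Finset.prod_pow_eq_pow_sum _ _ _).symm
      rw [hpow, powProd, descProd, Finsupp.prod, Finsupp.prod, Nat.cast_prod, Nat.cast_prod,
        ← Finset.prod_mul_distrib]
      refine Finset.prod_le_prod (fun i _ => ?_) fun i hi => ?_
      · have h5 : 0 ≤ 1 - nsize s / ν := by
          rw [sub_nonneg, div_le_one hν]; exact hs
        positivity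
      · push_cast; exact hle i hi
    refine le_trans ?_ hp
    gcongr
    refine le_trans (le_of_eq ?_) (one_add_mul_le_pow (a := -(nsize s / ν : ℝ)) ?_ (nsize s))
    · ring
    · have : (nsize s : ℝ) / ν ≤ 1 := by rwa [div_le_one hν]
      linarith
  · refine le_trans (mul_nonpos_of_nonneg_of_nonpos (by positivity) ?_) (Nat.cast_nonneg _)
    push Not at hs
    rw [sub_nonpos, le_div_iff₀ hν, one_mul]
    have h1 : (1 : ℝ) ≤ nsize s := by
      have : 0 < nsize s := by exact_mod_cast hν.trans hs
      exact_mod_cast this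
    nlinarith

theorem descFactorial_mul_le (a b u v : ℕ) :
    a.descFactorial u * b.descFactorial v ≤ (a + b).descFactorial (u + v) := by
  rcases lt_or_ge a u with h | h
  · rw [Nat.descFactorial_eq_zero_iff_lt.2 h, zero_mul]; exact Nat.zero_le _
  · have := Nat.descFactorial_mul_descFactorial (n := a + b) (Nat.le_add_right u v)
    rw [Nat.add_sub_cancel_left] at this
    rw [← this, mul_comm]
    gcongr
    · omega
    · omega

theorem descProd_le_descFactorial (n u : ℕ →₀ ℕ) :
    descProd n u ≤ (nsize n).descFactorial (nsize u) := by
  have key : ∀ s : Finset ℕ, ∏ i ∈ s, (n i).descFactorial (u i) ≤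
      (∑ i ∈ s, n i).descFactorial (∑ i ∈ s, u i) := by
    intro s
    induction s using Finset.induction_on with
    | empty => simp
    | insert i s hi ih =>
      rw [Finset.prod_insert hi, Finset.sum_insert hi, Finset.sum_insert hi]
      exact (Nat.mul_le_mul_left _ ih).trans (descFactorial_mul_le _ _ _ _)
  have hn : nsize n = ∑ i ∈ n.support ∪ u.support, n i :=
    Finsupp.sum_of_support_subset _ Finset.subset_union_left _ (by simp)
  have hu : nsize u = ∑ i ∈ n.support ∪ u.support, u i :=
    Finsupp.sum_of_support_subset _ Finset.subset_union_right _ (by simp)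
  rw [descProd, Finsupp.prod_of_support_subset _ (Finset.subset_union_right (s₁ := n.support)) _
    (by simp), hn, hu]
  exact key _

theorem descProd_add (n s u : ℕ →₀ ℕ) :
    descProd n (s + u) = descProd (n - s) u * descProd n s := by
  have h1 : s.support ⊆ (s + u).support := Finsupp.support_mono le_self_add
  have h2 : u.support ⊆ (s + u).support := Finsupp.support_mono le_add_self
  rw [descProd, descProd, descProd, Finsupp.prod,
    Finsupp.prod_of_support_subset _ h1 _ (by simp),
    Finsupp.prod_of_support_subset _ h2 _ (by simp), ← Finset.prod_mul_distrib]
  refine Finset.prod_congr rfl fun i _ => ?_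
  have := Nat.descFactorial_mul_descFactorial (n := n i) (Nat.le_add_right (s i) (u i))
  rw [Nat.add_sub_cancel_left] at this
  simp [← this]

theorem exists_add_nsize_eq (t : ℕ →₀ ℕ) (k : ℕ) (hk : k ≤ nsize t) :
    ∃ s u, t = s + u ∧ nsize s = k := by
  induction k with
  | zero => exact ⟨0, t, by simp, by simp⟩
  | succ k ih =>
    obtain ⟨s, u, rfl, hs⟩ := ih (by omega)
    have hu : u ≠ 0 := by
      rintro rfl
      rw [add_zero] at hk; omega
    obtain ⟨i, hi⟩ := Finsupp.support_nonempty_iff.2 hu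
    refine ⟨s + Finsupp.single i 1, u - Finsupp.single i 1, ?_, ?_⟩
    · rw [add_assoc, single_add_tsub hi]
    · rw [nsize_add, nsize_single, hs]

theorem descProd_le_pow (n s : ℕ →₀ ℕ) (R : ℝ) (h : ∀ i, (n i : ℝ) ≤ R) :
    (descProd n s : ℝ) ≤ R ^ nsize s := by
  rw [nsize_eq_sum, ← Finset.prod_pow_eq_pow_sum, descProd, Finsupp.prod, Nat.cast_prod]
  refine Finset.prod_le_prod (fun _ _ => Nat.cast_nonneg _) fun i _ => ?_
  refine le_trans (Nat.cast_le.2 (Nat.descFactorial_le_pow _ _)) ?_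
  push_cast
  gcongr
  exact h i

theorem powProd_le_pow (n s : ℕ →₀ ℕ) (R : ℝ) (h : ∀ i, (n i : ℝ) ≤ R) :
    (powProd n s : ℝ) ≤ R ^ nsize s := by
  rw [nsize_eq_sum, ← Finset.prod_pow_eq_pow_sum, powProd, Finsupp.prod, Nat.cast_prod]
  refine Finset.prod_le_prod (fun _ _ => Nat.cast_nonneg _) fun i _ => ?_
  push_cast
  gcongr
  exact h i

theorem nsize_mul_piDist (T : PlaneTree) (n : ℕ →₀ ℕ) (hN : 0 < nsize n) :
    nsize n * piDist (empDist n) T * (nsize n : ℝ) ^ totalDegree (degStat T) =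
      powProd n (degStat T) := by
  have hN' : (nsize n : ℝ) ≠ 0 := by exact_mod_cast hN.ne'
  have h1 : piDist (empDist n) T * (nsize n : ℝ) ^ nsize (degStat T) =
      powProd n (degStat T) := by
    rw [nsize_eq_sum (degStat T), ← Finset.prod_pow_eq_pow_sum, piDist, powProd, Finsupp.prod,
      Finsupp.prod, ← Finset.prod_mul_distrib, Nat.cast_prod]
    refine Finset.prod_congr rfl fun i _ => ?_
    rw [empDist, ← mul_pow, div_mul_cancel₀ _ hN', Nat.cast_pow]
  rw [← h1, nsize_degStat, pow_add, pow_one]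
  ring

theorem piDist_empDist_nonneg (T : PlaneTree) (n : ℕ →₀ ℕ) : 0 ≤ piDist (empDist n) T := by
  rw [piDist, Finsupp.prod]
  exact Finset.prod_nonneg fun _ _ => pow_nonneg (div_nonneg (Nat.cast_nonneg _) (Nat.cast_nonneg _)) _

/-- The `q`-th factorial moment of the number of fringe trees equal to a given tree. -/
noncomputable def factorialMoment (T' : PlaneTree) (q : ℕ) (n : ℕ →₀ ℕ) : ℝ :=
  mean n (fun T => ((countTree T' T).choose q : ℝ)) * q.factorial

theorem mean_nonneg (n : ℕ →₀ ℕ) {f : PlaneTree → ℝ} (h : ∀ T, 0 ≤ f T) : 0 ≤ mean n f :=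
  div_nonneg (Finset.sum_nonneg fun T _ => h T) (Nat.cast_nonneg _)

theorem factorialMoment_nonneg (T' : PlaneTree) (q : ℕ) (n : ℕ →₀ ℕ) :
    0 ≤ factorialMoment T' q n :=
  mul_nonneg (mean_nonneg n fun _ => Nat.cast_nonneg _) (Nat.cast_nonneg _)

theorem nsize_pos_of_isDegStat {n : ℕ →₀ ℕ} (h : IsDegStat n) : 0 < nsize n := by
  have h1 : nsize n = 1 + totalDegree n := h
  omega

theorem factorialMoment_mul_le (T' : PlaneTree) (q : ℕ) (n : ℕ →₀ ℕ) (h : IsDegStat n) :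
    factorialMoment T' q n *
        (1 - ((q * totalDegree (degStat T') : ℕ) : ℝ) ^ 2 / nsize n) ≤
      (nsize n * piDist (empDist n) T') ^ q := by
  have hN := nsize_pos_of_isDegStat h
  have hN' : (0 : ℝ) < nsize n := by exact_mod_cast hN
  have h1 := mean_choose T' q n h
  have h2 := pow_mul_le_descFactorial (nsize n) (q * totalDegree (degStat T')) hN
  have h3 : (descProd n (q • degStat T') : ℝ) ≤
      (nsize n * piDist (empDist n) T') ^ q * (nsize n : ℝ) ^ (q * totalDegree (degStat T')) := by
    refine (Nat.cast_le.2 (descProd_le_powProd _ _)).trans (le_of_eq ?_)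
    rw [powProd_smul, Nat.cast_pow, ← nsize_mul_piDist T' n hN, mul_pow, mul_comm q, ← pow_mul]
  refine le_of_mul_le_mul_right (a := (nsize n : ℝ) ^ (q * totalDegree (degStat T'))) ?_
    (by positivity)
  refine le_trans ?_ h3
  rw [← h1, mul_assoc]
  refine mul_le_mul_of_nonneg_left ?_ (factorialMoment_nonneg T' q n)
  linarith

theorem nsize_mul_piDist_le (T' : PlaneTree) (n : ℕ →₀ ℕ) (hN : 0 < nsize n) (r : ℝ)
    (hr : ∀ i, (n i : ℝ) ≤ r * nsize n) {i : ℕ} (hi : i ∈ (degStat T').support) :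
    nsize n * piDist (empDist n) T' ≤ n i * r ^ totalDegree (degStat T') := by
  have hN' : (0 : ℝ) < nsize n := by exact_mod_cast hN
  refine le_of_mul_le_mul_right (a := (nsize n : ℝ) ^ totalDegree (degStat T')) ?_
    (by positivity)
  rw [nsize_mul_piDist T' n hN, mul_assoc, ← mul_pow]
  have h1 : nsize (degStat T' - Finsupp.single i 1) = totalDegree (degStat T') := by
    have := nsize_tsub_single hi
    rw [nsize_degStat] at this; omega
  have h2 : powProd n (degStat T') = n i * powProd n (degStat T' - Finsupp.single i 1) := by
    conv_lhs => rw [← single_add_tsub hi, powProd,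
      Finsupp.prod_add_index' (by simp) fun _ _ _ => pow_add _ _ _,
      Finsupp.prod_single_index (by simp), pow_one]
    rfl
  rw [h2, Nat.cast_mul, ← h1]
  gcongr
  exact powProd_le_pow _ _ _ hr

theorem le_factorialMoment (T' : PlaneTree) (q : ℕ) (n : ℕ →₀ ℕ) (h : IsDegStat n) (r : ℝ)
    (hr0 : 0 < r) (hr : ∀ i, (n i : ℝ) ≤ r * nsize n) :
    (nsize n * piDist (empDist n) T') ^ (q + 1) - (nsize n * piDist (empDist n) T') ^ q *
        (((q + 1 : ℕ) : ℝ) * size T') ^ 2 * r ^ totalDegree (degStat T') ≤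
      factorialMoment T' (q + 1) n := by
  have hN := nsize_pos_of_isDegStat h
  have hN' : (0 : ℝ) < nsize n := by exact_mod_cast hN
  have hx0 : 0 ≤ nsize n * piDist (empDist n) T' :=
    mul_nonneg hN'.le (piDist_empDist_nonneg T' n)
  rcases hx0.eq_or_lt with hx | hx
  · rw [← hx]
    refine le_trans ?_ (factorialMoment_nonneg T' _ n)
    rw [zero_pow (Nat.succ_ne_zero q), zero_sub, neg_nonpos]
    positivity
  set x := nsize n * piDist (empDist n) T' with hxdef
  set d := totalDegree (degStat T') with hd
  have h1 := mean_choose T' (q + 1) n h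
  have hsupp : ∀ i ∈ ((q + 1) • degStat T').support, x / r ^ d ≤ n i := by
    intro i hi
    have hi' : i ∈ (degStat T').support := by
      rw [Finsupp.mem_support_iff] at hi ⊢
      intro h0
      exact hi (by simp [h0])
    rw [div_le_iff₀ (by positivity)]
    exact nsize_mul_piDist_le T' n hN r hr hi'
  have h2 := mul_powProd_le_descProd n ((q + 1) • degStat T') (x / r ^ d) (by positivity) hsupp
  have h3 : ((powProd n ((q + 1) • degStat T') : ℕ) : ℝ) =
      x ^ (q + 1) * (nsize n : ℝ) ^ ((q + 1) * d) := by
    rw [powProd_smul, Nat.cast_pow, ← nsize_mul_piDist T' n hN, mul_pow, mul_comm (q + 1) d,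
      ← pow_mul]
  have h4 : (((nsize n - 1).descFactorial ((q + 1) * d) : ℕ) : ℝ) ≤
      (nsize n : ℝ) ^ ((q + 1) * d) := by
    refine (Nat.cast_le.2 (Nat.descFactorial_le_pow _ _)).trans ?_
    rw [Nat.cast_pow]
    gcongr
    omega
  refine le_of_mul_le_mul_right (a := (nsize n : ℝ) ^ ((q + 1) * d)) ?_ (by positivity)
  calc _ = (powProd n ((q + 1) • degStat T') : ℝ) *
        (1 - (nsize ((q + 1) • degStat T') : ℝ) ^ 2 / (x / r ^ d)) := by
        rw [h3, nsize_smul, nsize_degStat_eq_size]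
        push_cast
        field_simp
        ring
    _ ≤ _ := h2
    _ ≤ _ := by
      rw [← h1]
      exact mul_le_mul_of_nonneg_left h4 (factorialMoment_nonneg T' _ n)

theorem descFactorial_le_mul (c q N : ℕ) (h : c ≤ N) :
    c.descFactorial (q + 1) ≤ N ^ q * c := by
  refine (Nat.descFactorial_le_pow _ _).trans ?_
  rw [pow_succ]
  gcongr

theorem factorialMoment_succ_le (T' : PlaneTree) (q : ℕ) (n : ℕ →₀ ℕ) :
    factorialMoment T' (q + 1) n ≤ (nsize n : ℝ) ^ q * factorialMoment T' 1 n := by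
  rw [factorialMoment, factorialMoment, mul_comm, ← mean_const_mul, Nat.factorial_one,
    Nat.cast_one, mul_one, ← mean_const_mul]
  refine mean_mono n fun T hT => ?_
  have := descFactorial_le_mul (countTree T' T) q (nsize n) (countTree_le_nsize hT)
  rw [Nat.descFactorial_eq_factorial_mul_choose] at this
  rw [Nat.choose_one_right]
  exact_mod_cast this

theorem factorialMoment_one_le (T' : PlaneTree) (n : ℕ →₀ ℕ) (h : IsDegStat n) (r : ℝ)
    (hr0 : 0 < r) (hr : ∀ i, (n i : ℝ) ≤ r * nsize n) (k : ℕ) (hk : k ≤ size T')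
    (hkN : 2 * k ^ 2 ≤ nsize n) :
    factorialMoment T' 1 n ≤ 2 * nsize n * r ^ k := by
  have hN := nsize_pos_of_isDegStat h
  have hN' : (0 : ℝ) < nsize n := by exact_mod_cast hN
  have h1 := mean_choose T' 1 n h
  rw [one_smul, one_mul] at h1
  by_cases hle : degStat T' ≤ n
  · rw [← nsize_degStat_eq_size] at hk
    obtain ⟨s, u, hsu, rfl⟩ := exists_add_nsize_eq _ k hk
    have hsn : s ≤ n := le_trans (by rw [hsu]; exact le_self_add) hle
    have e1 : nsize (n - s) = nsize n - nsize s := by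
      obtain ⟨a, rfl⟩ := exists_add_of_le hsn
      rw [add_tsub_cancel_left, nsize_add, Nat.add_sub_cancel_left]
    have e2 := descProd_le_descFactorial (n - s) u
    have e3 := descProd_add n s u
    have hmN : nsize (degStat T') ≤ nsize n := by
      obtain ⟨a, rfl⟩ := exists_add_of_le hle
      rw [nsize_add]; omega
    have e4 : (nsize n - nsize s).descFactorial (nsize u) * (nsize n).descFactorial (nsize s) =
        nsize n * (nsize n - 1).descFactorial (totalDegree (degStat T')) := by
      have := Nat.descFactorial_mul_descFactorial (n := nsize n)
        (Nat.le_add_right (nsize s) (nsize u))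
      rw [Nat.add_sub_cancel_left, ← nsize_add, ← hsu] at this
      rw [this, nsize_degStat]
      conv_lhs => rw [← Nat.sub_add_cancel hN, add_comm 1, Nat.succ_descFactorial_succ,
        Nat.sub_add_cancel hN]
    have e5 : 0 < (nsize n - nsize s).descFactorial (nsize u) := by
      refine Nat.descFactorial_pos.2 ?_
      rw [hsu, nsize_add] at hmN; omega
    rw [e1] at e2
    have e6 : factorialMoment T' 1 n * (nsize n).descFactorial (nsize s) ≤
        nsize n * descProd n s := by
      refine le_of_mul_le_mul_left
        (a := ((nsize n - nsize s).descFactorial (nsize u) : ℝ)) ?_ (by exact_mod_cast e5)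
      calc _ = factorialMoment T' 1 n * (((nsize n - nsize s).descFactorial (nsize u) *
            (nsize n).descFactorial (nsize s) : ℕ) : ℝ) := by push_cast; ring
        _ = nsize n * (factorialMoment T' 1 n *
            (nsize n - 1).descFactorial (totalDegree (degStat T'))) := by
          rw [e4]; push_cast; ring
        _ = nsize n * (descProd n (degStat T') : ℝ) := by rw [factorialMoment, h1]
        _ = nsize n * ((descProd (n - s) u : ℝ) * descProd n s) := by
          rw [hsu, e3]; push_cast; ring
        _ ≤ nsize n * (((nsize n - nsize s).descFactorial (nsize u) : ℝ) * descProd n s) := by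
          gcongr
        _ = _ := by ring
    have e7 := descProd_le_pow n s _ hr
    have e8 := pow_mul_le_descFactorial (nsize n) (nsize s) hN
    have e9 : (nsize n : ℝ) ^ nsize s / 2 ≤ (nsize n).descFactorial (nsize s) := by
      refine le_trans ?_ (e8.trans (Nat.cast_le.2 (Nat.descFactorial_le _ (Nat.sub_le _ _))))
      rw [div_eq_mul_inv]
      gcongr
      have : ((nsize s : ℕ) : ℝ) ^ 2 / nsize n ≤ 1 / 2 := by
        rw [div_le_div_iff₀ hN' two_pos]
        have : ((2 * nsize s ^ 2 : ℕ) : ℝ) ≤ nsize n := Nat.cast_le.2 hkN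
        push_cast at this
        linarith
      linarith
    refine le_of_mul_le_mul_right (a := (nsize n : ℝ) ^ nsize s / 2) ?_ (by positivity)
    calc _ ≤ factorialMoment T' 1 n * (nsize n).descFactorial (nsize s) :=
          mul_le_mul_of_nonneg_left e9 (factorialMoment_nonneg _ _ _)
      _ ≤ nsize n * descProd n s := e6
      _ ≤ nsize n * (r * nsize n) ^ nsize s := by gcongr
      _ = _ := by rw [mul_pow]; ring
  · have h0 : factorialMoment T' 1 n = 0 := by
      have e := chooseSum_eq_zero (T' := T') (q := 1) (k := 1) (n := n) (by rwa [one_smul])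
      rw [← sum_choose_countTree] at e
      rw [factorialMoment, mean]
      have : ∑ T ∈ treeFinset n, ((countTree T' T).choose 1 : ℝ) = 0 := by exact_mod_cast e
      rw [this]; simp
    rw [h0]; positivity

theorem factorialMoment_zero (T' : PlaneTree) (n : ℕ →₀ ℕ) (h : IsDegStat n) :
    factorialMoment T' 0 n = 1 := by
  have := mean_choose T' 0 n h
  rw [zero_mul, Nat.descFactorial_zero, Nat.cast_one, mul_one, zero_smul] at this
  rw [factorialMoment, this]
  simp [descProd]

theorem eventually_apply_le (nseq : ℕ → (ℕ →₀ ℕ)) (p : ℕ → ℝ) (hcond : Condition1 nseq p)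
    (hp0 : p 0 < 1) (hp1 : p 1 < 1) :
    ∃ r : ℝ, 0 < r ∧ r < 1 ∧ ∀ᶠ κ in atTop, ∀ i, (nseq κ i : ℝ) ≤ r * nsize (nseq κ) := by
  obtain ⟨h1, -, -, -, h5⟩ := hcond
  obtain ⟨r, hr, hr1⟩ := exists_between (max_lt (max_lt hp0 hp1) (one_half_lt_one (α := ℝ)))
  rw [max_lt_iff, max_lt_iff] at hr
  obtain ⟨⟨hr0, hr1'⟩, hr2⟩ := hr
  refine ⟨r, by linarith, hr1, ?_⟩
  filter_upwards [(h5 0).eventually_lt_const hr0, (h5 1).eventually_lt_const hr1'] with κ k0 k1 i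
  have hN := nsize_pos_of_isDegStat (h1 κ)
  have hN' : (0 : ℝ) < nsize (nseq κ) := by exact_mod_cast hN
  rw [empDist, div_lt_iff₀ hN'] at k0 k1
  match i with
  | 0 => exact k0.le
  | 1 => exact k1.le
  | i + 2 =>
    have e1 : nsize (nseq κ) = 1 + totalDegree (nseq κ) := h1 κ
    have e2 : (i + 2) * nseq κ (i + 2) ≤ totalDegree (nseq κ) := by
      by_cases hi : i + 2 ∈ (nseq κ).support
      · exact Finset.single_le_sum (f := fun j => j * nseq κ j) (fun _ _ => Nat.zero_le _) hi
      · rw [Finsupp.notMem_support_iff.1 hi]; simp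
    have e3 : 2 * nseq κ (i + 2) ≤ nsize (nseq κ) := by nlinarith
    have e4 : (2 : ℝ) * nseq κ (i + 2) ≤ nsize (nseq κ) := by exact_mod_cast e3
    nlinarith

theorem tendsto_succ_pow_mul_pow (r : ℝ) (hr0 : 0 < r) (hr1 : r < 1) (j : ℕ) :
    Tendsto (fun y : ℕ => ((y + 1 : ℕ) : ℝ) ^ j * r ^ y) atTop (𝓝 0) := by
  have h := (tendsto_pow_const_mul_const_pow_of_abs_lt_one j
    (by rwa [abs_of_pos hr0] : |r| < 1)).comp (tendsto_add_atTop_nat 1)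
  have h2 := h.const_mul r⁻¹
  rw [mul_zero] at h2
  refine h2.congr fun y => ?_
  simp only [Function.comp_apply, pow_succ]
  field_simp

theorem tendsto_sqrt_atTop : Tendsto Nat.sqrt atTop atTop :=
  tendsto_atTop_atTop.2 fun b => ⟨b * b, fun _ h => Nat.le_sqrt.2 h⟩

theorem tendsto_factorialMoment
    (nseq : ℕ → (ℕ →₀ ℕ)) (p : ℕ → ℝ) (Tseq : ℕ → PlaneTree) (lam : ℝ)
    (hcond : Condition1 nseq p) (hp0 : p 0 < 1) (hp1 : p 1 < 1)
    (hsize : Tendsto (fun κ => PlaneTree.size (Tseq κ)) atTop atTop)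
    (hconv : Tendsto (fun κ => (nsize (nseq κ) : ℝ) * piDist (empDist (nseq κ)) (Tseq κ))
      atTop (𝓝 lam)) (q : ℕ) :
    Tendsto (fun κ => factorialMoment (Tseq κ) q (nseq κ)) atTop (𝓝 (lam ^ q)) := by
  cases q with
  | zero =>
    simp only [factorialMoment_zero _ _ (hcond.1 _), pow_zero]
    exact tendsto_const_nhds
  | succ q =>
  obtain ⟨r, hr0, hr1, hr⟩ := eventually_apply_le nseq p hcond hp0 hp1
  have hK : Tendsto (fun κ => (nsize (nseq κ)).sqrt.sqrt) atTop atTop :=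
    (tendsto_sqrt_atTop.comp tendsto_sqrt_atTop).comp hcond.2.1
  have hsd : ∀ T, size T = totalDegree (degStat T) + 1 := fun T => by
    rw [← nsize_degStat_eq_size, nsize_degStat, add_comm]
  have hd : Tendsto (fun κ => totalDegree (degStat (Tseq κ))) atTop atTop := by
    refine tendsto_atTop.2 fun b => ?_
    filter_upwards [hsize.eventually_ge_atTop (b + 1)] with κ h
    have := hsd (Tseq κ)
    omega
  refine tendsto_of_tendsto_of_tendsto_of_le_of_le' (g := fun κ =>
      (nsize (nseq κ) * piDist (empDist (nseq κ)) (Tseq κ)) ^ (q + 1) -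
        (nsize (nseq κ) * piDist (empDist (nseq κ)) (Tseq κ)) ^ q *
        (((q + 1 : ℕ) : ℝ) * size (Tseq κ)) ^ 2 * r ^ totalDegree (degStat (Tseq κ)))
    (h := fun κ => (nsize (nseq κ) * piDist (empDist (nseq κ)) (Tseq κ)) ^ (q + 1) /
        (1 - ((q + 1 : ℕ) : ℝ) ^ 2 / ((nsize (nseq κ)).sqrt.sqrt : ℝ) ^ 2) +
        2 * ((((nsize (nseq κ)).sqrt.sqrt + 1 : ℕ) : ℝ) ^ (4 * (q + 1)) *
          r ^ (nsize (nseq κ)).sqrt.sqrt)) ?_ ?_ ?_ ?_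
  · have h1 := ((tendsto_succ_pow_mul_pow r hr0 hr1 2).comp hd).const_mul (((q + 1 : ℕ) : ℝ) ^ 2)
    have h2 := (hconv.pow (q + 1)).sub ((hconv.pow q).mul h1)
    rw [mul_zero, mul_zero, sub_zero] at h2
    refine h2.congr fun κ => ?_
    simp only [Function.comp_apply, hsd]
    ring
  · have h1 : Tendsto (fun κ => ((q + 1 : ℕ) : ℝ) ^ 2 / ((nsize (nseq κ)).sqrt.sqrt : ℝ) ^ 2)
        atTop (𝓝 0) :=
      tendsto_const_nhds.div_atTop ((tendsto_pow_atTop two_ne_zero).comp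
        (tendsto_natCast_atTop_atTop.comp hK))
    have h2 := ((tendsto_succ_pow_mul_pow r hr0 hr1 (4 * (q + 1))).comp hK).const_mul 2
    have h3 := ((hconv.pow (q + 1)).div (h1.const_sub 1) (by norm_num)).add h2
    rw [sub_zero, div_one, mul_zero, add_zero] at h3
    exact h3
  · filter_upwards [hr] with κ hκ
    exact le_factorialMoment _ _ _ (hcond.1 κ) r hr0 hκ
  · filter_upwards [hr, hK.eventually_ge_atTop (q + 2)] with κ hκ hKκ
    have hN := nsize_pos_of_isDegStat (hcond.1 κ)
    set n := nseq κ
    set K := (nsize n).sqrt.sqrt with hKdef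
    set x := nsize n * piDist (empDist n) (Tseq κ) with hx
    have hx0 : 0 ≤ x := mul_nonneg (Nat.cast_nonneg _) (piDist_empDist_nonneg _ _)
    have hK1 : K ^ 4 ≤ nsize n := by
      have e1 : K ^ 2 ≤ (nsize n).sqrt := by rw [pow_two]; exact Nat.sqrt_le _
      have e2 : (nsize n).sqrt ^ 2 ≤ nsize n := by rw [pow_two]; exact Nat.sqrt_le _
      calc K ^ 4 = (K ^ 2) ^ 2 := by ring
        _ ≤ (nsize n).sqrt ^ 2 := by gcongr
        _ ≤ _ := e2
    have hK2 : nsize n ≤ (K + 1) ^ 4 := by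
      have e1 : (nsize n).sqrt + 1 ≤ (K + 1) ^ 2 := by
        rw [pow_two]; exact Nat.lt_succ_sqrt _
      have e2 : nsize n ≤ ((nsize n).sqrt + 1) ^ 2 := by
        rw [pow_two]; exact (Nat.lt_succ_sqrt _).le
      calc nsize n ≤ ((nsize n).sqrt + 1) ^ 2 := e2
        _ ≤ ((K + 1) ^ 2) ^ 2 := by gcongr
        _ = _ := by ring
    have hKpos : (0 : ℝ) < K := by exact_mod_cast (by omega : 0 < K)
    have hden : 0 < 1 - ((q + 1 : ℕ) : ℝ) ^ 2 / (K : ℝ) ^ 2 := by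
      rw [sub_pos, div_lt_one (by positivity)]
      have : ((q + 1 : ℕ) : ℝ) < K := by exact_mod_cast (by omega : q + 1 < K)
      gcongr
    rcases le_or_gt (size (Tseq κ)) K with hs | hs
    · have h1 := factorialMoment_mul_le (Tseq κ) (q + 1) n (hcond.1 κ)
      have h2 : (((q + 1) * totalDegree (degStat (Tseq κ)) : ℕ) : ℝ) ^ 2 / nsize n ≤
          ((q + 1 : ℕ) : ℝ) ^ 2 / (K : ℝ) ^ 2 := by
        have hdK : totalDegree (degStat (Tseq κ)) ≤ K := by
          have := hsd (Tseq κ); omega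
        calc _ ≤ (((q + 1) * K : ℕ) : ℝ) ^ 2 / ((K ^ 4 : ℕ) : ℝ) := by gcongr
          _ = _ := by push_cast; field_simp
      have h3 : factorialMoment (Tseq κ) (q + 1) n *
          (1 - ((q + 1 : ℕ) : ℝ) ^ 2 / (K : ℝ) ^ 2) ≤ x ^ (q + 1) := by
        refine le_trans ?_ h1
        gcongr
        exact factorialMoment_nonneg _ _ _
      rw [← le_div_iff₀ hden] at h3
      refine h3.trans (le_add_of_nonneg_right (by positivity))
    · have h1 := factorialMoment_one_le (Tseq κ) n (hcond.1 κ) r hr0 hκ K hs.le (by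
        have : 2 * K ^ 2 ≤ K ^ 4 := by
          have : 2 ≤ K ^ 2 := by nlinarith
          calc 2 * K ^ 2 ≤ K ^ 2 * K ^ 2 := by gcongr
            _ = K ^ 4 := by ring
        omega)
      have h2 := factorialMoment_succ_le (Tseq κ) q n
      have h3 : (nsize n : ℝ) ≤ ((K + 1 : ℕ) : ℝ) ^ 4 := by exact_mod_cast hK2
      refine le_trans ?_ (le_add_of_nonneg_left (by positivity))
      calc _ ≤ (nsize n : ℝ) ^ q * factorialMoment (Tseq κ) 1 n := h2
        _ ≤ (nsize n : ℝ) ^ q * (2 * nsize n * r ^ K) := by gcongr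
        _ = 2 * ((nsize n : ℝ) ^ (q + 1) * r ^ K) := by ring
        _ ≤ 2 * ((((K + 1 : ℕ) : ℝ) ^ 4) ^ (q + 1) * r ^ K) := by gcongr
        _ = _ := by rw [← pow_mul]

theorem choose_mul_choose_add (k m j : ℕ) :
    (k + j).choose k * (k + m).choose (k + j) = (k + m).choose k * m.choose j := by
  rcases le_or_gt j m with h | h
  · rw [mul_comm, Nat.choose_mul (Nat.le_add_right k j), Nat.add_sub_cancel_left,
      Nat.add_sub_cancel_left]
  · rw [Nat.choose_eq_zero_of_lt (by omega : k + m < k + j), Nat.choose_eq_zero_of_lt h, mul_zero,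
      mul_zero]

/-- The Bonferroni inequality for the indicator of `c = k`. -/
theorem abs_indicator_sub_sum_choose_le (c k J : ℕ) :
    |(if c = k then (1 : ℝ) else 0) -
      ∑ j ∈ Finset.range (J + 1), (-1 : ℝ) ^ j * (k + j).choose k * c.choose (k + j)| ≤
      (k + (J + 1)).choose k * c.choose (k + (J + 1)) := by
  rcases lt_or_ge c k with hck | hck
  · rw [if_neg hck.ne, Finset.sum_eq_zero fun j _ => by
      rw [Nat.choose_eq_zero_of_lt (by omega : c < k + j), Nat.cast_zero, mul_zero], sub_zero,
      abs_zero]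
    positivity
  obtain ⟨m, rfl⟩ := Nat.exists_eq_add_of_le hck
  have h (j : ℕ) : ((k + j).choose k : ℝ) * (k + m).choose (k + j) =
      (k + m).choose k * m.choose j := by
    exact_mod_cast choose_mul_choose_add k m j
  simp only [mul_assoc, h]
  cases m with
  | zero =>
    rw [Finset.sum_range_succ', Finset.sum_eq_zero fun j _ => by simp]
    simp
  | succ m =>
    have halt : ∑ j ∈ Finset.range (J + 1), (-1 : ℝ) ^ j * ((m + 1).choose j : ℝ) =
        (-1) ^ J * (m.choose J : ℝ) := by
      exact_mod_cast congrArg (Int.cast : ℤ → ℝ)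
        (Int.alternating_sum_range_choose_eq_choose (n := m) (m := J))
    rw [if_neg (by omega), zero_sub, abs_neg,
      Finset.sum_congr rfl fun j _ => mul_left_comm ((-1 : ℝ) ^ j) _ _, ← Finset.mul_sum, halt,
      abs_mul, abs_mul, abs_pow, abs_neg, abs_one, one_pow, one_mul, Nat.abs_cast, Nat.abs_cast,
      Nat.choose_succ_succ]
    gcongr
    omega

theorem choose_mul_pow_div_factorial (lam : ℝ) (k j : ℕ) :
    ((k + j).choose k : ℝ) * (lam ^ (k + j) / (k + j).factorial) =
      lam ^ k / k.factorial * (lam ^ j / j.factorial) := by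
  have h : ((k + j).choose k : ℝ) * k.factorial * j.factorial = (k + j).factorial := by
    rw [Nat.choose_symm_add]
    exact_mod_cast Nat.add_choose_mul_factorial_mul_factorial k j
  have h1 : ((k + j).factorial : ℝ) ≠ 0 := by positivity
  have h2 : (k.factorial : ℝ) ≠ 0 := by positivity
  have h3 : (j.factorial : ℝ) ≠ 0 := by positivity
  field_simp
  rw [← h]
  ring

theorem hasSum_exp_real (x : ℝ) : HasSum (fun j : ℕ => x ^ j / j.factorial) (Real.exp x) := by
  rw [Real.exp_eq_exp_ℝ]
  exact NormedSpace.expSeries_div_hasSum_exp x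

theorem hasSum_choose_mul_poissonPMF (lam : ℝ) (j : ℕ) :
    HasSum (fun k : ℕ => (k.choose j : ℝ) * poissonPMF lam k) (lam ^ j / j.factorial) := by
  rw [← hasSum_nat_add_iff' j, Finset.sum_eq_zero fun i hi => by
    rw [Nat.choose_eq_zero_of_lt (Finset.mem_range.1 hi), Nat.cast_zero, zero_mul], sub_zero]
  have h := (hasSum_exp_real lam).mul_left (lam ^ j / j.factorial * Real.exp (-lam))
  rw [mul_assoc, ← Real.exp_add, neg_add_cancel, Real.exp_zero, mul_one] at h
  refine h.congr_fun fun i => ?_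
  have h1 := choose_mul_pow_div_factorial lam j i
  rw [poissonPMF, add_comm i j]
  linear_combination Real.exp (-lam) * h1

/-- Convergence of the binomial moments to those of `Po(lam)` gives convergence of the point
probabilities. -/
theorem tendsto_prob_of_tendsto_mean_choose (n : ℕ → (ℕ →₀ ℕ)) (X : ℕ → PlaneTree → ℕ) (lam : ℝ)
    (h : ∀ q, Tendsto (fun κ => mean (n κ) fun T => ((X κ T).choose q : ℝ)) atTop
      (𝓝 (lam ^ q / q.factorial))) (k : ℕ) :
    Tendsto (fun κ => prob (n κ) fun T => X κ T = k) atTop (𝓝 (poissonPMF lam k)) := by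
  have hlimS : Tendsto (fun J => ∑ j ∈ Finset.range (J + 1),
      (-1 : ℝ) ^ j * (k + j).choose k * (lam ^ (k + j) / (k + j).factorial)) atTop
      (𝓝 (poissonPMF lam k)) := by
    have h1 := ((hasSum_exp_real (-lam)).mul_left (lam ^ k / k.factorial)).tendsto_sum_nat.comp
      (tendsto_add_atTop_nat 1)
    have h2 : lam ^ k / k.factorial * Real.exp (-lam) = poissonPMF lam k := by
      rw [poissonPMF]; ring
    rw [h2] at h1
    refine h1.congr fun J => Finset.sum_congr rfl fun j _ => ?_
    rw [mul_assoc, choose_mul_pow_div_factorial, neg_pow lam]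
    ring
  have hlimB : Tendsto (fun J => ((k + (J + 1)).choose k : ℝ) *
      (lam ^ (k + (J + 1)) / (k + (J + 1)).factorial)) atTop (𝓝 0) := by
    have h1 := ((hasSum_exp_real lam).summable.tendsto_atTop_zero.comp
      (tendsto_add_atTop_nat 1)).const_mul (lam ^ k / k.factorial)
    rw [mul_zero] at h1
    exact h1.congr fun J => (choose_mul_pow_div_factorial lam k (J + 1)).symm
  have hbound (J κ : ℕ) : |prob (n κ) (fun T => X κ T = k) -
      ∑ j ∈ Finset.range (J + 1),
        (-1 : ℝ) ^ j * (k + j).choose k * mean (n κ) (fun T => ((X κ T).choose (k + j) : ℝ))| ≤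
      (k + (J + 1)).choose k * mean (n κ) (fun T => ((X κ T).choose (k + (J + 1)) : ℝ)) := by
    simp only [prob_eq_mean, ← mean_const_mul]
    rw [← mean_sum, sub_eq_add_neg, ← neg_one_mul, ← mean_const_mul, ← mean_add]
    refine (abs_mean_le _ _).trans (mean_mono _ fun T _ => ?_)
    simp only [neg_one_mul, ← sub_eq_add_neg]
    convert abs_indicator_sub_sum_choose_le (X κ T) k J
  refine Metric.tendsto_atTop'.2 fun ε hε => ?_
  have hJ := (((hlimS.sub_const (poissonPMF lam k)).abs).add hlimB).eventually_lt_const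
    (u := ε) (by simpa using hε)
  obtain ⟨J, hJ⟩ := hJ.exists
  have hκ := ((((tendsto_finsetSum (Finset.range (J + 1)) fun j _ =>
    (h (k + j)).const_mul ((-1 : ℝ) ^ j * (k + j).choose k)).sub_const (poissonPMF lam k)).abs).add
      ((h (k + (J + 1))).const_mul ((k + (J + 1)).choose k : ℝ))).eventually_lt_const hJ
  obtain ⟨K, hK⟩ := eventually_atTop.1 hκ
  refine ⟨K, fun κ hκ => ?_⟩
  rw [Real.dist_eq]
  have h1 := abs_sub_le (prob (n κ) (fun T => X κ T = k)) (∑ j ∈ Finset.range (J + 1),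
        (-1 : ℝ) ^ j * (k + j).choose k * mean (n κ) (fun T => ((X κ T).choose (k + j) : ℝ)))
        (poissonPMF lam k)
  linarith [hbound J κ, hK κ hκ.le]

theorem mul_choose_eq (c j : ℕ) :
    (c : ℝ) * c.choose j = j * c.choose j + (j + 1) * c.choose (j + 1) := by
  have h : (c.choose (j + 1) : ℝ) * (j + 1) = c.choose j * (c - j) := by
    rcases le_or_gt j c with hj | hj
    · have := Nat.choose_succ_right_eq c j
      rw [← Nat.cast_sub hj]
      exact_mod_cast this
    · rw [Nat.choose_eq_zero_of_lt hj, Nat.choose_eq_zero_of_lt (hj.trans (Nat.lt_succ_self j))]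
      simp
  linear_combination -h

/-- Convergence of the binomial moments to those of `Po(lam)` gives convergence of the mixed
power and binomial moments. -/
theorem exists_hasSum_tendsto_mean_pow_mul_choose (n : ℕ → (ℕ →₀ ℕ)) (X : ℕ → PlaneTree → ℕ)
    (lam : ℝ) (h : ∀ q, Tendsto (fun κ => mean (n κ) fun T => ((X κ T).choose q : ℝ)) atTop
      (𝓝 (lam ^ q / q.factorial))) (q j : ℕ) :
    ∃ s, HasSum (fun k : ℕ => (k : ℝ) ^ q * k.choose j * poissonPMF lam k) s ∧
      Tendsto (fun κ => mean (n κ) fun T => (X κ T : ℝ) ^ q * (X κ T).choose j) atTop (𝓝 s) := by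
  induction q generalizing j with
  | zero =>
    refine ⟨lam ^ j / j.factorial, ?_, ?_⟩
    · simpa using hasSum_choose_mul_poissonPMF lam j
    · simpa using h j
  | succ q ih =>
    obtain ⟨s, hs, hs'⟩ := ih j
    obtain ⟨t, ht, ht'⟩ := ih (j + 1)
    have hrec (c : ℕ) : (c : ℝ) ^ (q + 1) * c.choose j =
        j * ((c : ℝ) ^ q * c.choose j) + (j + 1) * ((c : ℝ) ^ q * c.choose (j + 1)) := by
      linear_combination (c : ℝ) ^ q * mul_choose_eq c j
    refine ⟨j * s + (j + 1) * t, ?_, ?_⟩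
    · refine ((hs.mul_left (j : ℝ)).add (ht.mul_left ((j : ℝ) + 1))).congr_fun fun k => ?_
      rw [hrec]
      ring
    · refine ((hs'.const_mul (j : ℝ)).add (ht'.const_mul ((j : ℝ) + 1))).congr fun κ => ?_
      rw [← mean_const_mul, ← mean_const_mul, ← mean_add]
      simp only [hrec]

theorem tendsto_expect_pow_of_tendsto_mean_choose (n : ℕ → (ℕ →₀ ℕ)) (X : ℕ → PlaneTree → ℕ)
    (lam : ℝ) (h : ∀ q, Tendsto (fun κ => mean (n κ) fun T => ((X κ T).choose q : ℝ)) atTop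
      (𝓝 (lam ^ q / q.factorial))) (q : ℕ) :
    Tendsto (fun κ => expect (n κ) fun T => X κ T ^ q) atTop (𝓝 (poissonMoment lam q)) := by
  obtain ⟨s, hs, hlim⟩ := exists_hasSum_tendsto_mean_pow_mul_choose n X lam h q 0
  simp only [Nat.choose_zero_right, Nat.cast_one, mul_one] at hs hlim
  rw [poissonMoment, hs.tsum_eq]
  simpa only [expect_eq_mean, Nat.cast_pow] using hlim

/-- Theorem 3.2(i): Poisson limit for the number of fringe trees equal to a growing tree. -/
theorem fringe_growing_poisson
    (nseq : ℕ → (ℕ →₀ ℕ)) (p : ℕ → ℝ) (Tseq : ℕ → PlaneTree) (lam : ℝ)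
    (hcond : Condition1 nseq p) (hp0 : p 0 < 1) (hp1 : p 1 < 1)
    (hsize : Tendsto (fun κ => PlaneTree.size (Tseq κ)) atTop atTop)
    (hlam : 0 ≤ lam)
    (hconv : Tendsto (fun κ => (nsize (nseq κ) : ℝ) * piDist (empDist (nseq κ)) (Tseq κ))
      atTop (𝓝 lam)) :
    (∀ k : ℕ, Tendsto
      (fun κ => prob (nseq κ) (fun T => PlaneTree.countTree (Tseq κ) T = k))
      atTop (𝓝 (poissonPMF lam k))) ∧
    (∀ q : ℕ, Tendsto
      (fun κ => expect (nseq κ) (fun T => (PlaneTree.countTree (Tseq κ) T) ^ q))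
      atTop (𝓝 (poissonMoment lam q))) := by
  have h (q : ℕ) : Tendsto (fun κ => mean (nseq κ) fun T => ((countTree (Tseq κ) T).choose q : ℝ))
      atTop (𝓝 (lam ^ q / q.factorial)) := by
    refine ((tendsto_factorialMoment nseq p Tseq lam hcond hp0 hp1 hsize hconv q).div_const
      (q.factorial : ℝ)).congr fun κ => ?_
    rw [factorialMoment, mul_div_cancel_right₀ _ (by positivity)]
  exact ⟨tendsto_prob_of_tendsto_mean_choose nseq (fun κ => countTree (Tseq κ)) lam h,
    tendsto_expect_pow_of_tendsto_mean_choose nseq (fun κ => countTree (Tseq κ)) lam h⟩
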